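/- Let $q$ be a power of an odd prime $p$, and let $i$ be an integer with $1 \le i \le \frac{q^2-1}{2}$. Then $\frac{q^2-1}{\frac{q^2-1}{2}+i}\binom{\frac{q^2-1}{2}+i}{\frac{q^2-1}{2}-i} \equiv \frac{q^2-1}{4(q^2-i)}\binom{q^2-i}{i-1}\left(\frac{1}{16}\right)^{i-1} \pmod{p}.$ -/

import Mathlib

/-- `u` is a `p`-adic unit congruent to `1` modulo `p`. -/
def UnitOne (p : ℕ) (u : ℚ) : Prop :=
  ∃ c d : ℤ, (d : ZMod p) ≠ 0 ∧ (c : ZMod p) = (d : ZMod p) ∧ u = (c : ℚ) / (d : ℚ)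

theorem UnitOne.mul {p : ℕ} [Fact p.Prime] {u v : ℚ} (hu : UnitOne p u) (hv : UnitOne p v) :
    UnitOne p (u * v) := by
  obtain ⟨c, d, hd, h, rfl⟩ := hu
  obtain ⟨c', d', hd', h', rfl⟩ := hv
  refine ⟨c * c', d * d', ?_, ?_, ?_⟩
  · push_cast; exact mul_ne_zero hd hd'
  · push_cast; rw [h, h']
  · push_cast; rw [div_mul_div_comm]

theorem UnitOne.inv {p : ℕ} [Fact p.Prime] {u : ℚ} (hu : UnitOne p u) : UnitOne p u⁻¹ := by
  obtain ⟨c, d, hd, h, rfl⟩ := hu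
  exact ⟨d, c, by rwa [h], h.symm, by rw [inv_div]⟩

theorem UnitOne.shift {p : ℕ} [Fact p.Prime] (e m : ℕ) (s : ℤ) (hm : 0 < m) (hme : m < p ^ e) :
    UnitOne p (((m : ℚ) + s * (p : ℚ) ^ e) / m) := by
  have hp : p.Prime := Fact.out
  obtain ⟨k, m', hm', rfl⟩ := Nat.exists_eq_pow_mul_and_not_dvd hm.ne' p hp.ne_one
  have hm0 : 0 < m' := Nat.pos_of_ne_zero (by rintro rfl; simp at hm)
  have hke : k < e := by
    by_contra hcon
    push Not at hcon
    have h1 : p ^ e ≤ p ^ k := Nat.pow_le_pow_right hp.pos hcon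
    have h2 : p ^ k ≤ p ^ k * m' := Nat.le_mul_of_pos_right _ hm0
    omega
  obtain ⟨r, rfl⟩ := Nat.exists_eq_add_of_lt hke
  refine ⟨m' + s * p ^ (r + 1), m', ?_, ?_, ?_⟩
  · push_cast
    rwa [Ne, ZMod.natCast_eq_zero_iff]
  · push_cast
    simp
  · have hp0 : (p : ℚ) ≠ 0 := by exact_mod_cast hp.ne_zero
    have hm1 : (m' : ℚ) ≠ 0 := by exact_mod_cast hm0.ne'
    push_cast
    field_simp
    ring

theorem dickson_int (m k : ℕ) (hm : 0 < m) :
    ∃ A : ℕ, ((m + k : ℕ) : ℚ) / (m : ℚ) * (Nat.choose m k : ℚ) = (A : ℚ) := by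
  obtain ⟨m, rfl⟩ : ∃ r, m = r + 1 := ⟨m - 1, by omega⟩
  have hm0 : ((m + 1 : ℕ) : ℚ) ≠ 0 := by exact_mod_cast hm.ne'
  rcases k with _ | k
  · exact ⟨1, by rw [Nat.add_zero, div_self hm0]; simp⟩
  · refine ⟨Nat.choose (m + 1) (k + 1) + Nat.choose m k, ?_⟩
    have h : ((m + 1 : ℕ) : ℚ) * (Nat.choose m k : ℚ)
        = (Nat.choose (m + 1) (k + 1) : ℚ) * ((k + 1 : ℕ) : ℚ) := by
      exact_mod_cast Nat.add_one_mul_choose_eq m k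
    rw [div_mul_eq_mul_div, div_eq_iff hm0]
    push_cast at h ⊢
    linear_combination -h

theorem left_fact (n i : ℕ) (h1 : 1 ≤ i) (h2 : i ≤ n) :
    ((2 * n : ℕ) : ℚ) / ((n + i : ℕ) : ℚ) * (Nat.choose (n + i) (n - i) : ℚ)
      = 2 * n * ((n + i - 1).factorial : ℚ) / ((2 * i).factorial * (n - i).factorial) := by
  obtain ⟨k, rfl⟩ := Nat.exists_eq_add_of_le h2
  obtain ⟨j, rfl⟩ := Nat.exists_eq_add_of_le h1
  rw [Nat.cast_choose ℚ (by omega)]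
  have e1 : 1 + j + k + (1 + j) - (1 + j + k - (1 + j)) = 2 * (1 + j) := by omega
  have e2 : 1 + j + k - (1 + j) = k := by omega
  have e3 : 1 + j + k + (1 + j) = (2 * j + k + 1) + 1 := by omega
  rw [e1, e2, e3, Nat.factorial_succ, Nat.add_sub_cancel]
  have f1 : ((2 * j + k + 1 + 1 : ℕ) : ℚ) ≠ 0 := by positivity
  have f2 : ((2 * (1 + j)).factorial : ℚ) ≠ 0 := by positivity
  have f3 : (k.factorial : ℚ) ≠ 0 := by positivity
  push_cast at f1 ⊢
  field_simp

theorem right_fact (n i : ℕ) (h1 : 1 ≤ i) (h2 : i ≤ n) :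
    ((2 * n : ℕ) : ℚ) / (4 * ((2 * n + 1 - i : ℕ) : ℚ)) * (Nat.choose (2 * n + 1 - i) (i - 1) : ℚ)
      * (1 / 16 : ℚ) ^ (i - 1)
      = 2 * n * ((2 * n - i).factorial : ℚ)
        / (4 * 16 ^ (i - 1) * (i - 1).factorial * (2 * n + 2 - 2 * i).factorial) := by
  obtain ⟨k, rfl⟩ := Nat.exists_eq_add_of_le h2
  obtain ⟨j, rfl⟩ := Nat.exists_eq_add_of_le h1
  rw [Nat.cast_choose ℚ (by omega)]
  have e1 : 2 * (1 + j + k) + 1 - (1 + j) - (1 + j - 1) = 2 * k + 2 := by omega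
  have e2 : 1 + j - 1 = j := by omega
  have e3 : 2 * (1 + j + k) + 1 - (1 + j) = (j + 2 * k + 1) + 1 := by omega
  have e4 : 2 * (1 + j + k) - (1 + j) = j + 2 * k + 1 := by omega
  have e5 : 2 * (1 + j + k) + 2 - 2 * (1 + j) = 2 * k + 2 := by omega
  rw [e1, e2, e3, e4, e5, Nat.factorial_succ (j + 2 * k + 1)]
  have f1 : ((j + 2 * k + 1 + 1 : ℕ) : ℚ) ≠ 0 := by positivity
  have f2 : ((2 * k + 2).factorial : ℚ) ≠ 0 := by positivity
  have f3 : (j.factorial : ℚ) ≠ 0 := by positivity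
  rw [one_div, inv_pow]
  push_cast at f1 ⊢
  field_simp

theorem ratio_unit (p e n : ℕ) [Fact p.Prime] (he : 0 < e) (hn : 2 * n + 1 = p ^ e)
    (i : ℕ) (h1 : 1 ≤ i) (h2 : i ≤ n) : ∃ u : ℚ, UnitOne p u ∧
    2 * n * ((n + i - 1).factorial : ℚ) / ((2 * i).factorial * (n - i).factorial)
      = u * (2 * n * ((2 * n - i).factorial : ℚ)
        / (4 * 16 ^ (i - 1) * (i - 1).factorial * (2 * n + 2 - 2 * i).factorial)) := by
  have hN : ((p : ℚ)) ^ e = 2 * n + 1 := by exact_mod_cast hn.symm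
  induction i, h1 using Nat.le_induction with
  | base =>
    refine ⟨(2 * n) ^ 2, ?_, ?_⟩
    · have h := UnitOne.shift (p := p) e 1 (-1) one_pos (by omega)
      rw [hN] at h
      have h' := h.mul h
      convert h' using 1
      push_cast
      ring
    · obtain ⟨k, rfl⟩ := Nat.exists_eq_add_of_le h2
      have e1 : 1 + k - 1 = k := by omega
      have e2 : 1 + k + 1 - 1 = k + 1 := by omega
      have e3 : 2 * (1 + k) - 1 = 2 * k + 1 := by omega
      have e4 : 2 * (1 + k) + 2 - 2 * 1 = (2 * k + 1) + 1 := by omega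
      rw [e1, e2, e3, e4, Nat.factorial_succ k, Nat.factorial_succ (2 * k + 1)]
      have f2 : ((2 * k + 1).factorial : ℚ) ≠ 0 := by positivity
      have f3 : (k.factorial : ℚ) ≠ 0 := by positivity
      simp [Nat.factorial]
      field_simp
      ring
  | succ i hi ih =>
    obtain ⟨u, hu, hab⟩ := ih (by omega)
    obtain ⟨k, rfl⟩ := Nat.exists_eq_add_of_le h2
    obtain ⟨j, rfl⟩ := Nat.exists_eq_add_of_le hi
    -- with i = j+1, n = j + k + 2, N = 2j+2k+5
    have u1 := UnitOne.shift (p := p) e (2 * j + 3) (-1) (by omega) (by omega)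
    have u2 := UnitOne.shift (p := p) e (2 * j + 1) 1 (by omega) (by omega)
    have u3 := UnitOne.shift (p := p) e (2 * j + 1) (-1) (by omega) (by omega)
    have u4 := UnitOne.shift (p := p) e (2 * j + 2) (-1) (by omega) (by omega)
    have u5 := UnitOne.shift (p := p) e (j + 2) (-1) (by omega) (by omega)
    refine ⟨u * (_ * _ * _⁻¹ * _⁻¹ * _),
      hu.mul ((((u1.mul u2).mul u3.inv).mul u4.inv).mul u5), ?_⟩
    rw [hN]
    have e1 : 1 + j + 1 + k + (1 + j) - 1 = 2 * j + k + 2 := by omega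
    have e2 : 1 + j + 1 + k + (1 + j + 1) - 1 = 2 * j + k + 2 + 1 := by omega
    have e3 : 1 + j + 1 + k - (1 + j) = k + 1 := by omega
    have e4 : 1 + j + 1 + k - (1 + j + 1) = k := by omega
    have e5 : 2 * (1 + j) = 2 * j + 2 := by omega
    have e6 : 2 * (1 + j + 1) = 2 * j + 2 + 1 + 1 := by omega
    have e7 : 2 * (1 + j + 1 + k) - (1 + j) = j + 2 * k + 2 + 1 := by omega
    have e8 : 2 * (1 + j + 1 + k) - (1 + j + 1) = j + 2 * k + 2 := by omega
    have e9 : 1 + j - 1 = j := by omega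
    have e10 : 1 + j + 1 - 1 = j + 1 := by omega
    have e11 : 2 * (1 + j + 1 + k) + 2 - (2 * j + 2) = 2 * k + 2 + 1 + 1 := by omega
    have e12 : 2 * (1 + j + 1 + k) + 2 - (2 * j + 2 + 1 + 1) = 2 * k + 2 := by omega
    rw [e1, e3, e5, e7, e9, e11] at hab
    rw [e2, e4, e6, e8, e10, e12]
    rw [Nat.factorial_succ k, Nat.factorial_succ (j + 2 * k + 2), Nat.factorial_succ (2 * k + 2 + 1),
      Nat.factorial_succ (2 * k + 2)] at hab
    rw [Nat.factorial_succ (2 * j + k + 2), Nat.factorial_succ (2 * j + 2 + 1),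
      Nat.factorial_succ (2 * j + 2), Nat.factorial_succ j]
    have f1 : ((2 * j + k + 2).factorial : ℚ) ≠ 0 := by positivity
    have f2 : ((2 * j + 2).factorial : ℚ) ≠ 0 := by positivity
    have f3 : (k.factorial : ℚ) ≠ 0 := by positivity
    have f4 : (j.factorial : ℚ) ≠ 0 := by positivity
    have f5 : ((j + 2 * k + 2).factorial : ℚ) ≠ 0 := by positivity
    have f6 : ((2 * k + 2).factorial : ℚ) ≠ 0 := by positivity
    generalize ((2 * j + k + 2).factorial) = F1 at *
    generalize ((2 * j + 2).factorial) = F2 at *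
    generalize (k.factorial) = F3 at *
    generalize (j.factorial) = F4 at *
    generalize ((j + 2 * k + 2).factorial) = F5 at *
    generalize ((2 * k + 2).factorial) = F6 at *
    have hX : (2 * ((1 + j + 1 + k : ℕ) : ℚ)) ≠ 0 := by positivity
    push_cast at hab hX ⊢
    have s1 : (2 * (j : ℚ) + 3 + -1 * (2 * (1 + j + 1 + k) + 1)) = - (2 * k + 2) := by ring
    have s2 : (2 * (j : ℚ) + 1 + 1 * (2 * (1 + j + 1 + k) + 1)) = 2 * (2 * j + k + 3) := by ring
    have s3 : (2 * (j : ℚ) + 1 + -1 * (2 * (1 + j + 1 + k) + 1)) = - (2 * k + 4) := by ring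
    have s4 : (2 * (j : ℚ) + 2 + -1 * (2 * (1 + j + 1 + k) + 1)) = - (2 * k + 3) := by ring
    have s5 : ((j : ℚ) + 2 + -1 * (2 * (1 + j + 1 + k) + 1)) = - (j + 2 * k + 3) := by ring
    rw [s1, s2, s3, s4, s5]
    have g1 : (2 * (j : ℚ) + 1) ≠ 0 := by positivity
    have g2 : (2 * (j : ℚ) + 2) ≠ 0 := by positivity
    have g3 : (2 * (j : ℚ) + 3) ≠ 0 := by positivity
    have g4 : ((j : ℚ) + 2) ≠ 0 := by positivity
    have g5 : (2 * (k : ℚ) + 4) ≠ 0 := by positivity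
    have g6 : (2 * (k : ℚ) + 3) ≠ 0 := by positivity
    have g7 : ((k : ℚ) + 1) ≠ 0 := by positivity
    have g8 : ((j : ℚ) + 2 * k + 3) ≠ 0 := by positivity
    have hab' : (F1 : ℚ) / (F2 * ((k + 1) * F3)) = u * (((j + 2 * k + 3) * F5)
        / (4 * 16 ^ j * F4 * ((2 * k + 4) * ((2 * k + 3) * F6)))) := by
      apply mul_left_cancel₀ hX
      rw [← mul_div_assoc, hab]
      ring
    have hF1 : (F1 : ℚ) = u * (((j + 2 * k + 3) * F5)
        / (4 * 16 ^ j * F4 * ((2 * k + 4) * ((2 * k + 3) * F6)))) * (F2 * ((k + 1) * F3)) := by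
      rw [← hab']; field_simp
    rw [hF1, pow_succ]
    field_simp
    ring

/-- Coefficient congruence behind the rotation property of Dickson polynomials:
for `1 ≤ i ≤ (q²-1)/2`, the rational numbers
`(q²-1)/((q²-1)/2 + i) * C((q²-1)/2 + i, (q²-1)/2 - i)` and
`(q²-1)/(4(q² - i)) * C(q² - i, i - 1) * (1/16)^(i-1)` are congruent mod `p`. -/
theorem coeff_congruence (p s q : ℕ) [Fact p.Prime] (hodd : Odd p) (hs : 0 < s)
    (hq : q = p ^ s) (i : ℕ) (h1 : 1 ≤ i) (h2 : i ≤ (q ^ 2 - 1) / 2) :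
    ((((q ^ 2 - 1 : ℕ) : ℚ) / (((q ^ 2 - 1) / 2 + i : ℕ) : ℚ) *
        (Nat.choose ((q ^ 2 - 1) / 2 + i) ((q ^ 2 - 1) / 2 - i) : ℚ) : ℚ) : ZMod p) =
    ((((q ^ 2 - 1 : ℕ) : ℚ) / (4 * ((q ^ 2 - i : ℕ) : ℚ)) *
        (Nat.choose (q ^ 2 - i) (i - 1) : ℚ) * (1 / 16 : ℚ) ^ (i - 1) : ℚ) : ZMod p) := by
  have hp : p.Prime := Fact.out
  have hN : q ^ 2 = p ^ (s * 2) := by rw [hq, pow_mul]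
  have hNodd : Odd (q ^ 2) := by rw [hN]; exact hodd.pow
  obtain ⟨n, hn⟩ := hNodd
  rw [hn] at h2 ⊢
  have e1 : 2 * n + 1 - 1 = 2 * n := by omega
  have e2 : 2 * n / 2 = n := by omega
  rw [e1, e2] at h2 ⊢
  obtain ⟨u, ⟨c, d, hd, hcd, rfl⟩, hab⟩ :=
    ratio_unit p (s * 2) n (by omega) (by rw [← hN, hn]) i h1 h2
  rw [← left_fact n i h1 h2, ← right_fact n i h1 h2] at hab
  obtain ⟨A, hA⟩ := dickson_int (n + i) (n - i) (by omega)
  obtain ⟨B, hB⟩ := dickson_int (2 * n + 1 - i) (i - 1) (by omega)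
  rw [show n + i + (n - i) = 2 * n by omega] at hA
  rw [show 2 * n + 1 - i + (i - 1) = 2 * n by omega] at hB
  have hR : ((2 * n : ℕ) : ℚ) / (4 * ((2 * n + 1 - i : ℕ) : ℚ))
      * (Nat.choose (2 * n + 1 - i) (i - 1) : ℚ) * (1 / 16 : ℚ) ^ (i - 1)
      = ((B : ℕ) : ℚ) / ((4 * 16 ^ (i - 1) : ℕ) : ℚ) := by
    rw [← hB, one_div, inv_pow]
    have : ((2 * n + 1 - i : ℕ) : ℚ) ≠ 0 := by
      have : 2 * n + 1 - i ≠ 0 := by omega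
      exact_mod_cast this
    push_cast
    field_simp
  rw [hA, hR] at hab
  rw [hA, hR]
  have h2p : ((2 : ℕ) : ZMod p) ≠ 0 := by
    rw [Ne, ZMod.natCast_eq_zero_iff]
    intro h
    have := (Nat.prime_dvd_prime_iff_eq hp Nat.prime_two).1 h
    subst this
    exact absurd hodd (by decide)
  have hD : ((4 * 16 ^ (i - 1) : ℕ) : ZMod p) ≠ 0 := by
    rw [show 4 * 16 ^ (i - 1) = 2 ^ (2 + 4 * (i - 1)) by rw [pow_add, pow_mul]; norm_num]
    rw [Nat.cast_pow]
    exact pow_ne_zero _ h2p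
  have hd0 : (d : ℚ) ≠ 0 := by
    rintro h
    have : d = 0 := by exact_mod_cast h
    subst this
    simp at hd
  have hDq : ((4 * 16 ^ (i - 1) : ℕ) : ℚ) ≠ 0 := by positivity
  generalize 4 * 16 ^ (i - 1) = D at *
  have hZ : (A : ℤ) * D * d = B * c := by
    have : (A : ℚ) * D * d = B * c := by
      rw [hab]; field_simp
    exact_mod_cast this
  have hZ' := congrArg (Int.cast : ℤ → ZMod p) hZ
  push_cast at hZ'
  rw [hcd] at hZ'
  have hfin := mul_right_cancel₀ hd hZ'
  rw [Rat.cast_div_of_ne_zero (by simpa using isUnit_one.ne_zero) (by simpa using hD)]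
  rw [Rat.cast_natCast, Rat.cast_natCast, Rat.cast_natCast, eq_div_iff hD, hfin]
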